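/- Let d ≥ 2, let q > (d−1)/2, α > 0, β ≥ 0. Let K̂ be an equilateral reference simplex in ℝ^{d−1} with edge matrix Ê, area |K̂| > 0, and altitude â. For k = 1, …, N let K_k be a surface simplex in ℝ^d with edge matrix E_k, let M_k ∈ ℝ^{d×d} be symmetric positive definite, set F_k = E_k Ê⁻¹ and J_k = (F_kᵀ M_k F_k)⁻¹, and suppose G̃_k is a real number with G̃_k ≥ α (tr J_k)^q − β. Define I_h = Σ_k |K̂| det(F_kᵀ M_k F_k)^{1/2} G̃_k and B = Σ_k |K̂| det(F_kᵀ M_k F_k)^{1/2}, and assume I_h + βB > 0. Then for every k, the minimum altitude a_k of K_k with respect to M_k satisfies a_k^{2q−d+1} ≥ (α â^{2q} / ((d−1)^{(d−1)/2}(d−1)!)) · (I_h + βB)^{−1}. -/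

import Mathlib

open Matrix MeasureTheory

/-- If `w` is a combination with zero total weight of the points `p j`, and `p i - p j` has inner
product `1` with `w` for all `j ≠ i`, then the altitude of `p i` over the other points is `1 / ‖w‖`. -/
theorem infDist_affineSpan_mul_norm_eq_one {ι E : Type*} [Fintype ι] [Nontrivial ι]
    [NormedAddCommGroup E] [InnerProductSpace ℝ E] (p : ι → E) (i : ι) (u : ι → ℝ) (w : E)
    (hu : ∑ j, u j = 0) (hw : w = ∑ j, u j • p j)
    (h : ∀ j, j ≠ i → inner ℝ (p i - p j) w = 1) :
    Metric.infDist (p i) (affineSpan ℝ (p '' {j | j ≠ i}) : Set E) * ‖w‖ = 1 := by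
  classical
  obtain ⟨k, hk⟩ := exists_ne i
  have hw0 : w ≠ 0 := by
    rintro rfl
    simpa using h k hk
  have hwpos : 0 < ‖w‖ := norm_pos_iff.2 hw0
  have hui : u i = ‖w‖ ^ 2 := by
    have h1 : ∀ j, u j * inner ℝ (p i - p j) w = u j - if j = i then u j else 0 := by
      intro j
      by_cases hj : j = i
      · simp [hj]
      · simp [h j hj, hj]
    have h2 : ∑ j, u j * inner ℝ (p i - p j) w = - ‖w‖ ^ 2 := by
      have h3 : ∑ j, u j • (p i - p j) = -w := by
        simp [smul_sub, ← Finset.sum_smul, hu, hw]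
      rw [← real_inner_self_eq_norm_sq, ← inner_neg_left, ← h3, sum_inner]
      simp [real_inner_smul_left]
    rw [Finset.sum_congr rfl fun j _ => h1 j] at h2
    simp [hu] at h2
    exact h2
  have hface : ∀ y ∈ affineSpan ℝ (p '' {j | j ≠ i}), inner ℝ (p i - y) w = 1 := by
    intro y hy
    refine affineSpan_induction hy ?_ fun c a b d ha hb hd => ?_
    · rintro _ ⟨j, hj, rfl⟩
      exact h j hj
    · have : p i - (c • (a -ᵥ b) +ᵥ d) = c • (p i - a) - c • (p i - b) + (p i - d) := by
        simp only [vsub_eq_sub, vadd_eq_add, smul_sub]; abel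
      rw [this]
      simp [inner_add_left, inner_sub_left (c • (p i - a)), real_inner_smul_left, ha, hb, hd]
  have hne : (affineSpan ℝ (p '' {j | j ≠ i}) : Set E).Nonempty :=
    ⟨p k, subset_affineSpan ℝ _ ⟨k, hk, rfl⟩⟩
  have hy : p i - (‖w‖ ^ 2)⁻¹ • w ∈ affineSpan ℝ (p '' {j | j ≠ i}) := by
    let b : ι → ℝ := fun j => (Pi.single i 1 : ι → ℝ) j - (‖w‖ ^ 2)⁻¹ * u j
    have hb1 : ∑ j, b j = 1 := by
      simp [b, ← Finset.mul_sum, hu]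
    have hbi : b i = 0 := by
      simp [b, hui, hwpos.ne']
    have hcomb : p i - (‖w‖ ^ 2)⁻¹ • w = (Finset.univ).affineCombination ℝ p b := by
      rw [Finset.affineCombination_eq_linear_combination _ _ _ hb1]
      simp only [b, sub_smul, Finset.sum_sub_distrib, mul_smul, ← Finset.smul_sum]
      simp [Pi.single_apply, ← hw]
    rw [hcomb]
    have hsub : (Finset.univ).affineCombination ℝ p b
        = (Finset.univ.erase i).affineCombination ℝ p b := by
      have hb1' : ∑ j ∈ Finset.univ.erase i, b j = 1 := by
        rw [Finset.sum_erase _ hbi, hb1]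
      rw [Finset.affineCombination_eq_linear_combination _ _ _ hb1,
        Finset.affineCombination_eq_linear_combination _ _ _ hb1', Finset.sum_erase]
      simp [hbi]
    rw [hsub]
    refine affineCombination_mem_affineSpan_image ?_ ?_ p
    · rw [Finset.sum_erase _ hbi, hb1]
    · intro j hj hj'
      simp_all
  apply le_antisymm
  · have h1 := Metric.infDist_le_dist_of_mem (x := p i) hy
    have h2 : dist (p i) (p i - (‖w‖ ^ 2)⁻¹ • w) = ‖w‖⁻¹ := by
      rw [dist_eq_norm, sub_sub_cancel, norm_smul]
      simp; field_simp
    rw [h2] at h1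
    calc _ ≤ ‖w‖⁻¹ * ‖w‖ := by gcongr
      _ = 1 := inv_mul_cancel₀ hwpos.ne'
  · rw [← div_le_iff₀ hwpos, Metric.le_infDist hne]
    intro y hy
    rw [div_le_iff₀ hwpos, dist_eq_norm, ← hface y hy]
    exact real_inner_le_norm _ _

/-- The differentials of the barycentric coordinates, in the coordinates given by the edges
from vertex `0`. -/
def baryDiff (n : ℕ) : Fin (n + 1) → Fin n → ℝ :=
  Fin.cons (fun _ => -1) fun j => Pi.single j 1

/-- An edge matrix applied to `v` is a combination of the vertices with zero total weight. -/
theorem toLp_edgeMatrix_mulVec {m n : ℕ} (p : Fin (n + 1) → EuclideanSpace ℝ (Fin m))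
    (A : Matrix (Fin m) (Fin n) ℝ) (hA : ∀ i j, A i j = p j.succ i - p 0 i) (v : Fin n → ℝ) :
    WithLp.toLp 2 (A *ᵥ v) = ∑ j, (Fin.cons (-∑ j, v j) v : Fin (n + 1) → ℝ) j • p j := by
  ext r
  simp only [mulVec, dotProduct, hA, sub_mul, Finset.sum_sub_distrib, ← Finset.mul_sum,
    Fin.sum_univ_succ, Fin.cons_zero, Fin.cons_succ, PiLp.add_apply, PiLp.smul_apply,
    WithLp.ofLp_sum, Finset.sum_apply, smul_eq_mul, mul_comm (v _)]
  ring

theorem edgeMatrix_mulVec_injective {m n : ℕ} (p : Fin (n + 1) → EuclideanSpace ℝ (Fin m))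
    (hp : AffineIndependent ℝ p) (A : Matrix (Fin m) (Fin n) ℝ)
    (hA : ∀ i j, A i j = p j.succ i - p 0 i) : Function.Injective A.mulVec := by
  refine (injective_iff_map_eq_zero A.mulVecLin).2 fun v hv => ?_
  have h := toLp_edgeMatrix_mulVec p A hA v
  rw [← mulVecLin_apply, hv, WithLp.toLp_zero] at h
  ext j
  simpa using affineIndependent_iff.1 hp Finset.univ _ (by simp [Fin.sum_univ_succ]) h.symm
    j.succ (Finset.mem_univ _)

/-- The squared altitudes of a simplex are the inverses of values of the quadratic form given by
the inverse Gram matrix of its edges. -/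
theorem infDist_affineSpan_sq_mul_eq_one {m n : ℕ} (hn : 1 ≤ n)
    (p : Fin (n + 1) → EuclideanSpace ℝ (Fin m)) (A : Matrix (Fin m) (Fin n) ℝ)
    (hA : ∀ i j, A i j = p j.succ i - p 0 i) (hdet : IsUnit (Aᵀ * A).det) (i : Fin (n + 1)) :
    Metric.infDist (p i) (affineSpan ℝ (p '' {j | j ≠ i}) : Set (EuclideanSpace ℝ (Fin m))) ^ 2 *
      (baryDiff n i ⬝ᵥ (Aᵀ * A)⁻¹ *ᵥ baryDiff n i) = 1 := by
  have : Nontrivial (Fin (n + 1)) := Fin.nontrivial_iff_two_le.2 (by omega)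
  set v : Fin n → ℝ := (Aᵀ * A)⁻¹ *ᵥ baryDiff n i with hv
  set w : EuclideanSpace ℝ (Fin m) := WithLp.toLp 2 (A *ᵥ v) with hw
  have hAv : Aᵀ *ᵥ (A *ᵥ v) = baryDiff n i := by
    rw [mulVec_mulVec, hv, mulVec_mulVec, Matrix.mul_nonsing_inv _ hdet, one_mulVec]
  have hinner : ∀ j : Fin n, inner ℝ (p j.succ - p 0) w = baryDiff n i j := by
    intro j
    rw [← hAv]
    simp [PiLp.inner_apply, hw, mulVec, dotProduct, hA, mul_comm]
  have hnorm : ‖w‖ ^ 2 = baryDiff n i ⬝ᵥ v := by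
    rw [EuclideanSpace.real_norm_sq_eq, ← hAv, mulVec_transpose, ← dotProduct_mulVec]
    simp [hw, dotProduct, pow_two]
  have key := infDist_affineSpan_mul_norm_eq_one p i (Fin.cons (-∑ j, v j) v) w
    (by simp [Fin.sum_univ_succ])
    (toLp_edgeMatrix_mulVec p A hA v)
    (by
      intro j hj
      have hz : ∀ j : Fin (n + 1), inner ℝ (p j - p 0) w = (Fin.cons 0 (baryDiff n i) : Fin (n + 1) → ℝ) j := by
        intro j
        refine Fin.cases ?_ (fun j => ?_) j
        · simp
        · simpa using hinner j
      rw [← sub_sub_sub_cancel_right (p i) (p j) (p 0), inner_sub_left, hz, hz]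
      clear hz hinner hnorm hAv
      clear_value v w
      induction i using Fin.cases with
      | zero =>
        obtain ⟨j, rfl⟩ := Fin.exists_succ_eq.2 hj
        simp [baryDiff]
      | succ i =>
        induction j using Fin.cases with
        | zero => simp [baryDiff]
        | succ j =>
          have : j ≠ i := by rintro rfl; exact hj rfl
          simp [baryDiff, this])
  rw [← hnorm, ← mul_pow, key, one_pow]

open scoped MatrixOrder Matrix.Norms.L2Operator in
theorem Matrix.PosSemidef.dotProduct_mulVec_le_trace_mul {ι : Type*} [Fintype ι] [DecidableEq ι]
    {J : Matrix ι ι ℝ} (hJ : J.PosSemidef) (v : ι → ℝ) :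
    v ⬝ᵥ J *ᵥ v ≤ J.trace * (v ⬝ᵥ v) := by
  obtain ⟨C, rfl⟩ : ∃ C : Matrix ι ι ℝ, J = Cᵀ * C := by
    obtain ⟨C, hC⟩ := CStarAlgebra.nonneg_iff_eq_star_mul_self.mp hJ.nonneg
    exact ⟨C, by simpa [star_eq_conjTranspose] using hC⟩
  have h1 : v ⬝ᵥ (Cᵀ * C) *ᵥ v = ∑ r, (∑ s, C r s * v s) ^ 2 := by
    rw [← mulVec_mulVec, dotProduct_mulVec, vecMul_transpose]
    simp [dotProduct, mulVec, pow_two]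
  have h2 : (Cᵀ * C).trace = ∑ r, ∑ s, C r s ^ 2 := by
    rw [Finset.sum_comm]
    simp [trace, mul_apply, pow_two]
  rw [h1, h2, Finset.sum_mul]
  refine Finset.sum_le_sum fun r _ => ?_
  simpa [dotProduct, pow_two] using Finset.sum_mul_sq_le_sq_mul_sq Finset.univ (C r) v

theorem Matrix.PosSemidef.det_le_trace_pow {ι : Type*} [Fintype ι] [DecidableEq ι]
    {J : Matrix ι ι ℝ} (hJ : J.PosSemidef) : J.det ≤ J.trace ^ Fintype.card ι := by
  rw [hJ.1.det_eq_prod_eigenvalues, hJ.1.trace_eq_sum_eigenvalues]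
  refine (Finset.prod_le_prod (fun i _ => hJ.eigenvalues_nonneg i) fun i _ =>
    Finset.single_le_sum (f := fun i => hJ.1.eigenvalues i)
      (fun i _ => hJ.eigenvalues_nonneg i) (Finset.mem_univ i)).trans_eq ?_
  simp

theorem one_div_factorial_le_volume_cornerSimplex {n : ℕ} (hn : 1 ≤ n) :
    ENNReal.ofReal (1 / n.factorial) ≤
      volume {t : Fin n → ℝ | (∀ i, 0 ≤ t i) ∧ ∑ i, t i ≤ 1} := by
  set T : Set (Fin n → ℝ) := {t : Fin n → ℝ | (∀ i, 0 ≤ t i) ∧ ∑ i, t i ≤ 1} with hT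
  have : Nonempty (Fin n) := ⟨⟨0, hn⟩⟩
  let g : (Fin n → Bool) → (Fin n → ℝ) →ₗ[ℝ] (Fin n → ℝ) := fun ε =>
    Matrix.toLin' (Matrix.diagonal fun i => if ε i then 1 else -1)
  have hg : ∀ ε, volume (g ε '' T) = volume T := by
    intro ε
    rw [Measure.addHaar_image_linearMap]
    have : |∏ i, (if ε i then (1 : ℝ) else -1)| = 1 := by
      rw [Finset.abs_prod]
      exact Finset.prod_eq_one fun i _ => by split_ifs <;> simp
    simp [g, LinearMap.det_toLin', this]
  have hcover : {x : Fin n → ℝ | ∑ i, |x i| ^ (1 : ℝ) < 1} ⊆ ⋃ ε, g ε '' T := by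
    intro x hx
    simp only [Real.rpow_one, Set.mem_ofPred_eq] at hx
    refine Set.mem_iUnion.2 ⟨fun i => decide (0 ≤ x i), fun i => |x i|,
      ⟨fun i => abs_nonneg _, hx.le⟩, ?_⟩
    ext i
    simp only [g, toLin'_apply, mulVec_diagonal, decide_eq_true_eq]
    split_ifs with h
    · rw [abs_of_nonneg h, one_mul]
    · rw [abs_of_neg (not_le.1 h)]; ring
  have hle := (measure_mono hcover).trans (measure_iUnion_le (μ := volume) _)
  rw [volume_sum_rpow_lt_one (Fin n) le_rfl] at hle
  simp only [hg, tsum_fintype, Finset.sum_const, Finset.card_univ] at hle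
  have hG : Real.Gamma (1 + 1) = 1 := by norm_num
  simp only [div_one, hG, Fintype.card_fin, Real.Gamma_nat_eq_factorial, mul_one,
    Fintype.card_fun, Fintype.card_bool, nsmul_eq_mul] at hle
  have h2 : ENNReal.ofReal (2 ^ n / n.factorial) = ((2 ^ n : ℕ) : ENNReal) * ENNReal.ofReal (1 / n.factorial) := by
    rw [← ENNReal.ofReal_natCast, ← ENNReal.ofReal_mul (by positivity)]
    congr 1; push_cast; ring
  rw [h2] at hle
  exact (ENNReal.mul_le_mul_iff_right (by simp) (by simp)).1 hle

/-- Mathlib's Hausdorff measure is not normalised on Euclidean space; it dominates Lebesgue measure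
since the identity to the sup norm is `1`-Lipschitz. -/
theorem abs_det_div_factorial_le_hausdorffMeasure {n : ℕ} (hn : 1 ≤ n)
    (ξ : Fin (n + 1) → EuclideanSpace ℝ (Fin n)) (A : Matrix (Fin n) (Fin n) ℝ)
    (hA : ∀ i j, A i j = ξ j.succ i - ξ 0 i) :
    ENNReal.ofReal (|A.det| / n.factorial) ≤ μH[(n : ℝ)] (convexHull ℝ (Set.range ξ)) := by
  set T : Set (Fin n → ℝ) := {t : Fin n → ℝ | (∀ i, 0 ≤ t i) ∧ ∑ i, t i ≤ 1} with hT
  have hsub : (fun y => (WithLp.ofLp (ξ 0)) + y) '' (Matrix.toLin' A '' T) ⊆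
      (@WithLp.ofLp 2 (Fin n → ℝ)) '' convexHull ℝ (Set.range ξ) := by
    rintro _ ⟨_, ⟨t, ⟨ht0, ht1⟩, rfl⟩, rfl⟩
    refine ⟨∑ j, (Fin.cons (1 - ∑ i, t i) t : Fin (n + 1) → ℝ) j • ξ j, ?_, ?_⟩
    · refine (convex_convexHull ℝ _).sum_mem (fun j _ => ?_) ?_
        fun j _ => subset_convexHull ℝ _ ⟨j, rfl⟩
      · induction j using Fin.cases with
        | zero => simpa using ht1
        | succ j => simpa using ht0 j
      · simp [Fin.sum_univ_succ]
    · ext r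
      have h := congrArg (fun y : EuclideanSpace ℝ (Fin n) => y r) (toLp_edgeMatrix_mulVec ξ A hA t)
      simp only [Fin.sum_univ_succ, Fin.cons_zero, Fin.cons_succ, PiLp.add_apply,
        PiLp.smul_apply, smul_eq_mul] at h
      simp only [Fin.sum_univ_succ, Fin.cons_zero, Fin.cons_succ, PiLp.add_apply,
        PiLp.smul_apply, smul_eq_mul, toLin'_apply, Pi.add_apply, h]
      ring
  have hlip := (PiLp.lipschitzWith_ofLp 2 (fun _ : Fin n => ℝ)).hausdorffMeasure_image_le
    (Nat.cast_nonneg n) (convexHull ℝ (Set.range ξ))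
  have hvol := @hausdorffMeasure_pi_real (Fin n) _
  rw [Fintype.card_fin] at hvol
  rw [hvol] at hlip
  simp only [ENNReal.coe_one, ENNReal.one_rpow, one_mul] at hlip
  refine le_trans ?_ ((measure_mono hsub).trans hlip)
  rw [Set.image_add_left, measure_preimage_add, Measure.addHaar_image_linearMap,
    LinearMap.det_toLin', div_eq_mul_one_div, ENNReal.ofReal_mul (abs_nonneg _)]
  gcongr
  exact one_div_factorial_le_volume_cornerSimplex hn

theorem iInf_infDist_pos {m n : ℕ} (hn : 1 ≤ n)
    (p : Fin (n + 1) → EuclideanSpace ℝ (Fin m)) (A : Matrix (Fin m) (Fin n) ℝ)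
    (hA : ∀ i j, A i j = p j.succ i - p 0 i) (hdet : IsUnit (Aᵀ * A).det) :
    0 < ⨅ i, Metric.infDist (p i)
      (affineSpan ℝ (p '' {j | j ≠ i}) : Set (EuclideanSpace ℝ (Fin m))) := by
  obtain ⟨i, hi⟩ := exists_eq_ciInf_of_finite (f := fun i => Metric.infDist (p i)
      (affineSpan ℝ (p '' {j | j ≠ i}) : Set (EuclideanSpace ℝ (Fin m))))
  rw [← hi]
  refine lt_of_le_of_ne Metric.infDist_nonneg fun h0 => ?_
  have h := infDist_affineSpan_sq_mul_eq_one hn p A hA hdet i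
  rw [← h0] at h
  simp at h

/-- The Gram determinant of a simplex is bounded below by its minimum altitude. -/
theorem iInf_infDist_sq_div_pow_le_det {m n : ℕ} (hn : 1 ≤ n)
    (p : Fin (n + 1) → EuclideanSpace ℝ (Fin m)) (A : Matrix (Fin m) (Fin n) ℝ)
    (hA : ∀ i j, A i j = p j.succ i - p 0 i) (hG : (Aᵀ * A).PosDef) :
    ((⨅ i, Metric.infDist (p i)
      (affineSpan ℝ (p '' {j | j ≠ i}) : Set (EuclideanSpace ℝ (Fin m)))) ^ 2 / n) ^ n ≤
      (Aᵀ * A).det := by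
  have hdet : IsUnit (Aᵀ * A).det := hG.det_pos.ne'.isUnit
  have hpos := iInf_infDist_pos hn p A hA hdet
  have hle := fun i => ciInf_le (Set.finite_range fun i => Metric.infDist (p i)
    (affineSpan ℝ (p '' {j | j ≠ i}) : Set (EuclideanSpace ℝ (Fin m)))).bddBelow i
  set a := ⨅ i, Metric.infDist (p i)
    (affineSpan ℝ (p '' {j | j ≠ i}) : Set (EuclideanSpace ℝ (Fin m))) with ha
  have hn0 : (0 : ℝ) < n := by exact_mod_cast hn
  have hdiag : ∀ j, (Aᵀ * A)⁻¹ j j ≤ (a ^ 2)⁻¹ := by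
    intro j
    have h := infDist_affineSpan_sq_mul_eq_one hn p A hA hdet j.succ
    simp only [baryDiff, Fin.cons_succ, mulVec_single_one, single_one_dotProduct, col_apply] at h
    rw [eq_inv_of_mul_eq_one_right h]
    gcongr
    exact hle j.succ
  have htr : (Aᵀ * A)⁻¹.trace ≤ n / a ^ 2 := by
    refine (Finset.sum_le_sum fun j _ => hdiag j).trans_eq ?_
    simp [div_eq_mul_inv]
  have hSdet := hG.inv.posSemidef.det_le_trace_pow
  rw [Fintype.card_fin, det_nonsing_inv, Ring.inverse_eq_inv'] at hSdet
  have h := hSdet.trans (pow_le_pow_left₀ hG.inv.posSemidef.trace_nonneg htr n)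
  rw [inv_le_comm₀ hG.det_pos (by positivity), ← inv_pow, inv_div] at h
  exact h

/-- The trace of `T G⁻¹ Tᵀ`, for `G` the Gram matrix of a simplex and `T` the edge matrix of a
reference simplex with equal altitudes, controls the ratio of altitudes. -/
theorem sq_le_iInf_infDist_sq_mul_trace {m n : ℕ} (hn : 1 ≤ n)
    (p : Fin (n + 1) → EuclideanSpace ℝ (Fin m)) (A : Matrix (Fin m) (Fin n) ℝ)
    (hA : ∀ i j, A i j = p j.succ i - p 0 i) (hG : (Aᵀ * A).PosDef)
    (ξ : Fin (n + 1) → EuclideanSpace ℝ (Fin n)) (T : Matrix (Fin n) (Fin n) ℝ)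
    (hT : ∀ i j, T i j = ξ j.succ i - ξ 0 i) (hTdet : IsUnit T.det) (ahat : ℝ)
    (hahat : ∀ i, Metric.infDist (ξ i)
      (affineSpan ℝ (ξ '' {j | j ≠ i}) : Set (EuclideanSpace ℝ (Fin n))) = ahat) :
    ahat ^ 2 ≤ (⨅ i, Metric.infDist (p i)
      (affineSpan ℝ (p '' {j | j ≠ i}) : Set (EuclideanSpace ℝ (Fin m)))) ^ 2 *
      (T * (Aᵀ * A)⁻¹ * Tᵀ).trace := by
  have hdet : IsUnit (Aᵀ * A).det := hG.det_pos.ne'.isUnit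
  obtain ⟨i, hi⟩ := exists_eq_ciInf_of_finite (f := fun i => Metric.infDist (p i)
      (affineSpan ℝ (p '' {j | j ≠ i}) : Set (EuclideanSpace ℝ (Fin m))))
  rw [← hi]
  have h1 := infDist_affineSpan_sq_mul_eq_one hn p A hA hdet i
  have h2 := infDist_affineSpan_sq_mul_eq_one hn ξ T hT (by simpa using hTdet) i
  rw [hahat i] at h2
  set c := baryDiff n i
  set g : Fin n → ℝ := c ᵥ* T⁻¹ with hg
  have hgT : g ᵥ* T = c := by rw [hg, vecMul_vecMul, nonsing_inv_mul _ hTdet, vecMul_one]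
  have hgg : c ⬝ᵥ (Tᵀ * T)⁻¹ *ᵥ c = g ⬝ᵥ g := by
    rw [Matrix.mul_inv_rev, ← mulVec_mulVec, dotProduct_mulVec, ← transpose_nonsing_inv, mulVec_transpose]
  have hJ : (T * (Aᵀ * A)⁻¹ * Tᵀ).PosSemidef := by
    simpa using hG.inv.posSemidef.mul_mul_conjTranspose_same T
  have hgJ : g ⬝ᵥ (T * (Aᵀ * A)⁻¹ * Tᵀ) *ᵥ g = c ⬝ᵥ (Aᵀ * A)⁻¹ *ᵥ c := by
    rw [← mulVec_mulVec, mulVec_transpose, hgT, ← mulVec_mulVec, dotProduct_mulVec, hgT]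
  have h3 := hJ.dotProduct_mulVec_le_trace_mul g
  rw [hgJ, ← hgg] at h3
  set H := Metric.infDist (p i)
    (affineSpan ℝ (p '' {j | j ≠ i}) : Set (EuclideanSpace ℝ (Fin m)))
  calc ahat ^ 2 = ahat ^ 2 * H ^ 2 * (c ⬝ᵥ (Aᵀ * A)⁻¹ *ᵥ c) := by
        linear_combination -ahat ^ 2 * h1
    _ ≤ ahat ^ 2 * H ^ 2 * ((T * (Aᵀ * A)⁻¹ * Tᵀ).trace * (c ⬝ᵥ (Tᵀ * T)⁻¹ *ᵥ c)) := by
        gcongr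
    _ = H ^ 2 * (T * (Aᵀ * A)⁻¹ * Tᵀ).trace := by
        linear_combination H ^ 2 * (T * (Aᵀ * A)⁻¹ * Tᵀ).trace * h2

/-- (Key bound in the nonsingularity theorem.) Under the coercivity
condition `G̃_k ≥ α (tr J_k)^q − β` with `q > (d−1)/2` (here `d = n+1`), for the meshing
energy `I_h = Σ_k |K̂| det(F_kᵀ M_k F_k)^{1/2} G̃_k` and `B = Σ_k |K̂| det(F_kᵀ M_k F_k)^{1/2}`
with `I_h + βB > 0`, the minimum altitude `a_k` of each surface simplex `K_k` with respect
to the metric `M_k` satisfies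
`a_k^{2q−d+1} ≥ (α â^{2q} / ((d−1)^{(d−1)/2}(d−1)!)) (I_h + βB)⁻¹`,
where `K̂` is the equilateral reference simplex with altitude `â`, edge matrix `Ê` and area
`|K̂| = V`. -/
theorem min_altitude_lower_bound (n N : ℕ) (hn : 1 ≤ n) (hN : 1 ≤ N)
    (q α β : ℝ) (hq : (n : ℝ) / 2 < q) (hα : 0 < α) (hβ : 0 ≤ β)
    (ξ : Fin (n + 1) → EuclideanSpace ℝ (Fin n))
    (hξ : AffineIndependent ℝ ξ)
    (hequi : ∀ i j k l : Fin (n + 1), i ≠ j → k ≠ l → dist (ξ i) (ξ j) = dist (ξ k) (ξ l))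
    (Ehat : Matrix (Fin n) (Fin n) ℝ)
    (hEhat : ∀ i j, Ehat i j = ξ j.succ i - ξ 0 i)
    (hEhatUnit : IsUnit Ehat.det)
    (V : ℝ) (hV : V = (μH[(n : ℝ)] (convexHull ℝ (Set.range ξ))).toReal) (hVpos : 0 < V)
    (ahat : ℝ)
    (hahat : ∀ i : Fin (n + 1),
      Metric.infDist (ξ i)
        ((affineSpan ℝ (ξ '' {j | j ≠ i}) : AffineSubspace ℝ (EuclideanSpace ℝ (Fin n))) :
          Set (EuclideanSpace ℝ (Fin n))) = ahat)
    (x : Fin N → Fin (n + 1) → EuclideanSpace ℝ (Fin (n + 1)))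
    (hx : ∀ k, AffineIndependent ℝ (x k))
    (E : Fin N → Matrix (Fin (n + 1)) (Fin n) ℝ)
    (hE : ∀ k i j, E k i j = x k j.succ i - x k 0 i)
    (M R : Fin N → Matrix (Fin (n + 1)) (Fin (n + 1)) ℝ)
    (hM : ∀ k, (M k).PosDef) (hR : ∀ k, (R k).PosDef) (hRM : ∀ k, R k * R k = M k)
    (F : Fin N → Matrix (Fin (n + 1)) (Fin n) ℝ) (hF : ∀ k, F k = E k * Ehat⁻¹)
    (J : Fin N → Matrix (Fin n) (Fin n) ℝ) (hJ : ∀ k, J k = ((F k)ᵀ * M k * F k)⁻¹)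
    (Gt : Fin N → ℝ) (hGt : ∀ k, α * (J k).trace ^ q - β ≤ Gt k)
    (Ih B : ℝ)
    (hIh : Ih = ∑ k, V * Real.sqrt ((F k)ᵀ * M k * F k).det * Gt k)
    (hB : B = ∑ k, V * Real.sqrt ((F k)ᵀ * M k * F k).det)
    (hpos : 0 < Ih + β * B)
    (a : Fin N → ℝ)
    (ha : ∀ k, a k = ⨅ i : Fin (n + 1),
      Metric.infDist (Matrix.toEuclideanLin (R k) (x k i))
        ((affineSpan ℝ ((fun j => Matrix.toEuclideanLin (R k) (x k j)) '' {j | j ≠ i}) :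
          AffineSubspace ℝ (EuclideanSpace ℝ (Fin (n + 1)))) :
          Set (EuclideanSpace ℝ (Fin (n + 1))))) :
    ∀ k, α * ahat ^ (2 * q) / ((n : ℝ) ^ ((n : ℝ) / 2) * (n.factorial : ℝ)) *
        (Ih + β * B)⁻¹ ≤ a k ^ (2 * q - n) := by
  intro k
  set A : Matrix (Fin (n + 1)) (Fin n) ℝ := R k * E k with hAdef
  set p : Fin (n + 1) → EuclideanSpace ℝ (Fin (n + 1)) :=
    fun j => Matrix.toEuclideanLin (R k) (x k j) with hp
  have hA : ∀ i j, A i j = p j.succ i - p 0 i := by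
    intro i j
    simp [A, p, mul_apply, hE, mulVec, dotProduct, mul_sub]
  have hAA : ∀ k, (E k)ᵀ * M k * E k = (R k * E k)ᵀ * (R k * E k) := by
    intro k
    have hRT : (R k)ᵀ = R k := by simpa using (hR k).1.eq
    rw [transpose_mul, hRT, ← hRM k]
    simp only [Matrix.mul_assoc]
  have hG : (Aᵀ * A).PosDef := by
    rw [hAdef, ← hAA]
    simpa using (hM k).conjTranspose_mul_mul_same
      (edgeMatrix_mulVec_injective (x k) (hx k) (E k) (hE k))
  have hFMF : (F k)ᵀ * M k * F k = Ehat⁻¹ᵀ * (Aᵀ * A) * Ehat⁻¹ := by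
    rw [hF, hAdef, ← hAA, transpose_mul]
    simp only [Matrix.mul_assoc]
  have hJk : J k = Ehat * (Aᵀ * A)⁻¹ * Ehatᵀ := by
    rw [hJ, hFMF, Matrix.mul_inv_rev, Matrix.mul_inv_rev, nonsing_inv_nonsing_inv _ hEhatUnit,
      ← transpose_nonsing_inv, nonsing_inv_nonsing_inv _ hEhatUnit, Matrix.mul_assoc]
  have hJtr : ∀ k, 0 ≤ (J k).trace := by
    intro k
    rw [hJ]
    refine PosSemidef.trace_nonneg (PosSemidef.inv ?_)
    simpa using (hM k).posSemidef.conjTranspose_mul_mul_same (F k)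
  have hapos : 0 < a k := (ha k).symm ▸ iInf_infDist_pos hn p A hA hG.det_pos.ne'.isUnit
  have hdet : (a k ^ 2 / n) ^ n ≤ (Aᵀ * A).det :=
    (ha k).symm ▸ iInf_infDist_sq_div_pow_le_det hn p A hA hG
  have htr : ahat ^ 2 ≤ a k ^ 2 * (J k).trace := by
    rw [hJk, ha k]
    exact sq_le_iInf_infDist_sq_mul_trace hn p A hA hG ξ Ehat hEhat hEhatUnit ahat hahat
  have hahat0 : 0 ≤ ahat := hahat 0 ▸ Metric.infDist_nonneg
  have hEpos : 0 < |Ehat.det| := abs_pos.2 hEhatUnit.ne_zero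
  have hVle : |Ehat.det| / n.factorial ≤ V := by
    have h := abs_det_div_factorial_le_hausdorffMeasure hn ξ Ehat hEhat
    rw [hV]
    refine (ENNReal.ofReal_le_iff_le_toReal fun htop => ?_).1 h
    rw [hV, htop] at hVpos
    simp at hVpos
  have hsqrt : Real.sqrt ((F k)ᵀ * M k * F k).det =
      |Ehat.det|⁻¹ * Real.sqrt (Aᵀ * A).det := by
    have : ((F k)ᵀ * M k * F k).det = (|Ehat.det|⁻¹) ^ 2 * (Aᵀ * A).det := by
      rw [hFMF, det_mul, det_mul, det_transpose, det_nonsing_inv, Ring.inverse_eq_inv', inv_pow,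
        sq_abs]
      ring
    rw [this, Real.sqrt_mul (sq_nonneg _), Real.sqrt_sq (by positivity)]
  have hn0 : (0 : ℝ) < n := by exact_mod_cast hn
  have hsqrtdet : a k ^ (n : ℝ) / (n : ℝ) ^ ((n : ℝ) / 2) ≤ Real.sqrt (Aᵀ * A).det := by
    refine le_trans (le_of_eq ?_) (Real.sqrt_le_sqrt hdet)
    rw [Real.sqrt_eq_rpow, ← Real.rpow_natCast (a k ^ 2 / n), ← Real.rpow_mul (by positivity),
      Real.div_rpow (by positivity) hn0.le, ← Real.rpow_natCast (a k) 2, ← Real.rpow_mul hapos.le]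
    congr 2 <;> push_cast <;> ring
  have hfac : (0 : ℝ) < n.factorial := by exact_mod_cast n.factorial_pos
  have hvol : a k ^ (n : ℝ) / ((n : ℝ) ^ ((n : ℝ) / 2) * n.factorial) ≤
      V * Real.sqrt ((F k)ᵀ * M k * F k).det := by
    calc _ = a k ^ (n : ℝ) / (n : ℝ) ^ ((n : ℝ) / 2) / n.factorial := by rw [div_div]
      _ ≤ Real.sqrt (Aᵀ * A).det / n.factorial := by gcongr
      _ = |Ehat.det| / n.factorial * (|Ehat.det|⁻¹ * Real.sqrt (Aᵀ * A).det) := by field_simp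
      _ ≤ _ := by rw [hsqrt]; gcongr
  have hq0 : 0 < q := lt_trans (by positivity) hq
  have htrq : ahat ^ (2 * q) / a k ^ (2 * q) ≤ (J k).trace ^ q := by
    have h : ahat ^ 2 / a k ^ 2 ≤ (J k).trace := by
      rw [div_le_iff₀ (by positivity), mul_comm]
      exact htr
    refine le_trans (le_of_eq ?_) (Real.rpow_le_rpow (by positivity) h hq0.le)
    rw [Real.div_rpow (by positivity) (by positivity), Real.rpow_mul hahat0, Real.rpow_mul hapos.le]
    simp
  have henergy : V * Real.sqrt ((F k)ᵀ * M k * F k).det * (α * (J k).trace ^ q) ≤ Ih + β * B := by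
    have hsum : Ih + β * B = ∑ k, V * Real.sqrt ((F k)ᵀ * M k * F k).det * (Gt k + β) := by
      rw [hIh, hB, Finset.mul_sum, ← Finset.sum_add_distrib]
      exact Finset.sum_congr rfl fun _ _ => by ring
    have hterm : ∀ k, α * (J k).trace ^ q ≤ Gt k + β := fun k => by linarith [hGt k]
    have hnonneg : ∀ k, 0 ≤ α * (J k).trace ^ q := fun k =>
      mul_nonneg hα.le (Real.rpow_nonneg (hJtr k) q)
    rw [hsum]
    calc _ ≤ V * Real.sqrt ((F k)ᵀ * M k * F k).det * (Gt k + β) := by gcongr; exact hterm k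
      _ ≤ _ := Finset.single_le_sum
        (f := fun k => V * Real.sqrt ((F k)ᵀ * M k * F k).det * (Gt k + β))
        (fun k _ => mul_nonneg (by positivity) ((hnonneg k).trans (hterm k))) (Finset.mem_univ k)
  rw [← div_eq_mul_inv, div_le_iff₀ hpos]
  calc α * ahat ^ (2 * q) / ((n : ℝ) ^ ((n : ℝ) / 2) * n.factorial)
      = a k ^ (2 * q - n) * (a k ^ (n : ℝ) / ((n : ℝ) ^ ((n : ℝ) / 2) * n.factorial) *
          (α * (ahat ^ (2 * q) / a k ^ (2 * q)))) := by
        rw [Real.rpow_sub hapos]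
        have h1 : 0 < a k ^ (2 * q) := Real.rpow_pos_of_pos hapos _
        have h2 : 0 < a k ^ (n : ℝ) := Real.rpow_pos_of_pos hapos _
        field_simp
    _ ≤ a k ^ (2 * q - n) * (V * Real.sqrt ((F k)ᵀ * M k * F k).det *
          (α * (J k).trace ^ q)) := by gcongr
    _ ≤ _ := by gcongr
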